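/- Let C be a locally presentable category with a cofibrantly generated weak factorization system (L, R) such that ∅ → X lies in L for every object X, equipped with an exact cylinder I and a class An(I) of right I-anodyne extensions. Then a morphism i : K → M in the class L is a weak equivalence if and only if it has the left lifting property with respect to every right I-fibration whose codomain is right I-fibrant. -/

import Mathlib

set_option linter.unusedSectionVars false

open CategoryTheory CategoryTheory.Limits

universe v u

namespace Paper

variable {C : Type u} [Category.{v} C]

/-- The class of morphisms having the left lifting property against every morphism in `T`. -/
def llp (T : MorphismProperty C) : MorphismProperty C :=
  fun _ _ f => ∀ ⦃X Y : C⦄ (g : X ⟶ Y), T g → HasLiftingProperty f g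

/-- The class of morphisms having the right lifting property against every morphism in `T`. -/
def rlp (T : MorphismProperty C) : MorphismProperty C :=
  fun _ _ g => ∀ ⦃A B : C⦄ (f : A ⟶ B), T f → HasLiftingProperty f g

/-- The morphism property associated to a set of arrows. -/
def ofArrows (S : Set (Arrow C)) : MorphismProperty C :=
  fun _ _ f => Arrow.mk f ∈ S

/-- A (possibly large) category `J` is `κ`-filtered if every diagram in `J` indexed by a
small category of size `< κ` admits a cocone. -/
def IsCardinalFiltered (J : Cat.{v, v}) (κ : Cardinal.{v}) : Prop :=
  ∀ K : Cat.{v, v}, Cardinal.mk (Arrow K) < κ → ∀ F : K ⥤ J, Nonempty (Cocone F)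

/-- An object `X` is `κ`-presentable if `Hom(X, -)` preserves colimits of `κ`-filtered
diagrams. -/
def IsPresentableObj (κ : Cardinal.{v}) (X : C) : Prop :=
  ∀ J : Cat.{v, v}, IsCardinalFiltered J κ →
    PreservesColimitsOfShape J (coyoneda.obj (Opposite.op X))

/-- A category is locally presentable if it is cocomplete and there is a regular cardinal `κ`
and a small family of `κ`-presentable objects such that every object is a `κ`-filtered colimit
of objects of the family. -/
class LocallyPresentable (C : Type u) [Category.{v} C] extends HasColimits C : Prop where
  exists_presentable_generator :
    ∃ κ : Cardinal.{v}, κ.IsRegular ∧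
      ∃ (ι : Type v) (G : ι → C), (∀ i, IsPresentableObj κ (G i)) ∧
        ∀ X : C, ∃ (J : Cat.{v, v}) (F : J ⥤ C) (c : Cocone F),
          IsCardinalFiltered J κ ∧ Nonempty (IsColimit c) ∧
          (∀ j : J, ∃ i, Nonempty (F.obj j ≅ G i)) ∧ Nonempty (c.pt ≅ X)

/-- `(L, R)` is a cofibrantly generated weak factorization system such that every morphism
from the initial object is in `L`. -/
structure IsCofGenWFS [HasColimits C] (L R : MorphismProperty C) : Prop where
  exists_generating_set : ∃ S : Set (Arrow C), Small.{v} S ∧ L = llp (rlp (ofArrows S))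
  rlp_eq : R = rlp L
  factorization : ∀ ⦃X Y : C⦄ (f : X ⟶ Y),
    ∃ (Z : C) (i : X ⟶ Z) (p : Z ⟶ Y), L i ∧ R p ∧ i ≫ p = f
  initial_mem : ∀ X : C, L (initial.to X)

/-- A functorial cylinder on `C`. -/
structure Cylinder (C : Type u) [Category.{v} C] where
  I : C ⥤ C
  d0 : 𝟭 C ⟶ I
  d1 : 𝟭 C ⟶ I
  σ : I ⟶ 𝟭 C
  d0_σ : ∀ X : C, d0.app X ≫ σ.app X = 𝟙 X
  d1_σ : ∀ X : C, d1.app X ≫ σ.app X = 𝟙 X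

namespace Cylinder

variable (E : Cylinder C)

lemma d0_naturality' {K M : C} (f : K ⟶ M) :
    f ≫ E.d0.app M = E.d0.app K ≫ E.I.map f := by
  simpa using E.d0.naturality f

lemma d1_naturality' {K M : C} (f : K ⟶ M) :
    f ≫ E.d1.app M = E.d1.app K ≫ E.I.map f := by
  simpa using E.d1.naturality f

variable [HasColimits C]

/-- The canonical map `X ⊔ X ⟶ I(X)`. -/
noncomputable def ι (X : C) : X ⨿ X ⟶ E.I.obj X :=
  coprod.desc (E.d0.app X) (E.d1.app X)

lemma ι_naturality {K M : C} (f : K ⟶ M) :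
    coprod.map f f ≫ E.ι M = E.ι K ≫ E.I.map f := by
  have h0 := E.d0.naturality f
  have h1 := E.d1.naturality f
  simp only [Functor.id_map] at h0 h1
  apply coprod.hom_ext <;> simp [ι, h0, h1]

/-- The pushout-corner map `∂I ⊠ f : (M ⊔ M) ⊔_{K ⊔ K} I(K) ⟶ I(M)`. -/
noncomputable def boundaryBox {K M : C} (f : K ⟶ M) :
    pushout (coprod.map f f) (E.ι K) ⟶ E.I.obj M :=
  pushout.desc (E.ι M) (E.I.map f) (E.ι_naturality f)

/-- The pushout-corner map `∂0 ⊠ f : M ⊔_K I(K) ⟶ I(M)`. -/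
noncomputable def box0 {K M : C} (f : K ⟶ M) :
    pushout f (E.d0.app K) ⟶ E.I.obj M :=
  pushout.desc (E.d0.app M) (E.I.map f) (E.d0_naturality' f)

/-- The pushout-corner map `∂1 ⊠ f : M ⊔_K I(K) ⟶ I(M)`. -/
noncomputable def box1 {K M : C} (f : K ⟶ M) :
    pushout f (E.d1.app K) ⟶ E.I.obj M :=
  pushout.desc (E.d1.app M) (E.I.map f) (E.d1_naturality' f)

end Cylinder

/-- A cylinder is exact with respect to the class `L` if it preserves small colimits,
the maps `X ⊔ X ⟶ I(X)` are in `L`, and the pushout-corner maps of morphisms of `L` are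
again in `L`. -/
structure IsExactCylinder [HasColimits C] (E : Cylinder C) (L : MorphismProperty C) : Prop where
  preservesColimits : PreservesColimits E.I
  ι_mem : ∀ X : C, L (E.ι X)
  boundaryBox_mem : ∀ ⦃K M : C⦄ (f : K ⟶ M), L f → L (E.boundaryBox f)
  box0_mem : ∀ ⦃K M : C⦄ (f : K ⟶ M), L f → L (E.box0 f)
  box1_mem : ∀ ⦃K M : C⦄ (f : K ⟶ M), L f → L (E.box1 f)

/-- `An` is a class of right `I`-anodyne extensions. -/
structure IsRightAnodyneClass [HasColimits C] (E : Cylinder C) (L : MorphismProperty C)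
    (An : MorphismProperty C) : Prop where
  le : An ≤ L
  exists_generating_set : ∃ Λ : Set (Arrow C), Small.{v} Λ ∧ ofArrows Λ ≤ L ∧
    An = llp (rlp (ofArrows Λ))
  box1_mem : ∀ ⦃K M : C⦄ (f : K ⟶ M), L f → An (E.box1 f)
  boundaryBox_mem : ∀ ⦃K M : C⦄ (f : K ⟶ M), An f → An (E.boundaryBox f)

/-- `An` is a class of left `I`-anodyne extensions. -/
structure IsLeftAnodyneClass [HasColimits C] (E : Cylinder C) (L : MorphismProperty C)
    (An : MorphismProperty C) : Prop where
  le : An ≤ L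
  exists_generating_set : ∃ Λ : Set (Arrow C), Small.{v} Λ ∧ ofArrows Λ ≤ L ∧
    An = llp (rlp (ofArrows Λ))
  box0_mem : ∀ ⦃K M : C⦄ (f : K ⟶ M), L f → An (E.box0 f)
  boundaryBox_mem : ∀ ⦃K M : C⦄ (f : K ⟶ M), An f → An (E.boundaryBox f)

/-- A morphism is an `An`-fibration if it has the right lifting property against all
morphisms of `An`. -/
def IsFib (An : MorphismProperty C) {X Y : C} (p : X ⟶ Y) : Prop :=
  ∀ ⦃A B : C⦄ (f : A ⟶ B), An f → HasLiftingProperty f p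

/-- An object `W` is `An`-fibrant if the map `W ⟶ *` has the right lifting property against
all morphisms of `An`, i.e. every morphism to `W` extends along every morphism of `An`. -/
def IsFibrantObj (An : MorphismProperty C) (W : C) : Prop :=
  ∀ ⦃A B : C⦄ (f : A ⟶ B), An f → ∀ a : A ⟶ W, ∃ b : B ⟶ W, f ≫ b = a

namespace Cylinder

variable (E : Cylinder C)

/-- An `I`-homotopy from `f` to `g`. -/
def Homotopy {X Y : C} (f g : X ⟶ Y) : Prop :=
  ∃ h : E.I.obj X ⟶ Y, E.d0.app X ≫ h = f ∧ E.d1.app X ≫ h = g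

/-- `[X, Y]_I`, the quotient of `Hom(X, Y)` by the equivalence relation generated by
`I`-homotopy. -/
def HoHom (X Y : C) : Type v :=
  Quot (fun f g : X ⟶ Y => E.Homotopy f g)

/-- Precomposition `f^* : [B, W]_I ⟶ [A, W]_I`. -/
def precompQ {A B : C} (f : A ⟶ B) (W : C) : E.HoHom B W → E.HoHom A W :=
  Quot.lift (fun g => Quot.mk _ (f ≫ g)) (by
    rintro g g' ⟨h, h0, h1⟩
    apply Quot.sound
    refine ⟨E.I.map f ≫ h, ?_, ?_⟩
    · rw [← Category.assoc, ← E.d0_naturality' f, Category.assoc, h0]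
    · rw [← Category.assoc, ← E.d1_naturality' f, Category.assoc, h1])

end Cylinder

/-- `f` is a weak equivalence if it induces bijections `[B, W]_I ≅ [A, W]_I` for all
fibrant `W`. -/
def IsWeakEq (E : Cylinder C) (An : MorphismProperty C) {A B : C} (f : A ⟶ B) : Prop :=
  ∀ W : C, IsFibrantObj An W → Function.Bijective (E.precompQ f W)

/-- `f` is a retract of `f'`. -/
def IsRetractOf {X Y X' Y' : C} (f : X ⟶ Y) (f' : X' ⟶ Y') : Prop :=
  ∃ (i : X ⟶ X') (r : X' ⟶ X) (j : Y ⟶ Y') (s : Y' ⟶ Y),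
    i ≫ r = 𝟙 X ∧ j ≫ s = 𝟙 Y ∧ i ≫ f' = f ≫ j ∧ f' ≫ s = r ≫ f

/-- A model structure on a category: the classes of weak equivalences, cofibrations and
fibrations, subject to the two-out-of-three, retract, lifting and factorization axioms. -/
structure ModelStructure (C : Type u) [Category.{v} C] where
  weq : MorphismProperty C
  cof : MorphismProperty C
  fib : MorphismProperty C
  weq_id : ∀ X : C, weq (𝟙 X)
  weq_comp : ∀ ⦃X Y Z : C⦄ (f : X ⟶ Y) (g : Y ⟶ Z), weq f → weq g → weq (f ≫ g)
  weq_cancel_left : ∀ ⦃X Y Z : C⦄ (f : X ⟶ Y) (g : Y ⟶ Z), weq f → weq (f ≫ g) → weq g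
  weq_cancel_right : ∀ ⦃X Y Z : C⦄ (f : X ⟶ Y) (g : Y ⟶ Z), weq g → weq (f ≫ g) → weq f
  weq_retract : ∀ ⦃X Y X' Y' : C⦄ (f : X ⟶ Y) (f' : X' ⟶ Y'),
    IsRetractOf f f' → weq f' → weq f
  cof_retract : ∀ ⦃X Y X' Y' : C⦄ (f : X ⟶ Y) (f' : X' ⟶ Y'),
    IsRetractOf f f' → cof f' → cof f
  fib_retract : ∀ ⦃X Y X' Y' : C⦄ (f : X ⟶ Y) (f' : X' ⟶ Y'),
    IsRetractOf f f' → fib f' → fib f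
  lift_trivCof_fib : ∀ ⦃A B X Y : C⦄ (i : A ⟶ B) (p : X ⟶ Y),
    cof i → weq i → fib p → HasLiftingProperty i p
  lift_cof_trivFib : ∀ ⦃A B X Y : C⦄ (i : A ⟶ B) (p : X ⟶ Y),
    cof i → fib p → weq p → HasLiftingProperty i p
  fact_cof_trivFib : ∀ ⦃X Y : C⦄ (f : X ⟶ Y),
    ∃ (Z : C) (i : X ⟶ Z) (p : Z ⟶ Y), cof i ∧ fib p ∧ weq p ∧ i ≫ p = f
  fact_trivCof_fib : ∀ ⦃X Y : C⦄ (f : X ⟶ Y),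
    ∃ (Z : C) (i : X ⟶ Z) (p : Z ⟶ Y), cof i ∧ weq i ∧ fib p ∧ i ≫ p = f

/-- An object `W` is fibrant for a model structure if every morphism to `W` extends along
every trivial cofibration, i.e. `W ⟶ *` has the right lifting property against trivial
cofibrations. -/
def ModelStructure.Fibrant (M : ModelStructure C) (W : C) : Prop :=
  ∀ ⦃A B : C⦄ (i : A ⟶ B), M.cof i → M.weq i → ∀ a : A ⟶ W, ∃ b : B ⟶ W, i ≫ b = a

section Presentability

lemma isCardinalFiltered_iff_mathlib (J : Cat.{v, v}) (κ : Cardinal.{v}) [Fact κ.IsRegular] :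
    IsCardinalFiltered J κ ↔ CategoryTheory.IsCardinalFiltered J κ := by
  constructor
  · intro h
    exact ⟨fun {A} _ F hA => h (Cat.of A) (Cardinal.lift_lt.1 hA) F⟩
  · intro h K hK F
    exact h.nonempty_cocone F (Cardinal.lift_lt.2 hK)

lemma IsPresentableObj.isCardinalPresentable {κ : Cardinal.{v}} [Fact κ.IsRegular] {X : C}
    (h : IsPresentableObj κ X) : IsCardinalPresentable X κ where
  preservesColimitOfShape J _ hJ :=
    h (Cat.of J) ((isCardinalFiltered_iff_mathlib (Cat.of J) κ).2 hJ)

instance isLocallyPresentable [LocallyPresentable C] : IsLocallyPresentable.{v} C := by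
  obtain ⟨κ, hκ, ι, G, hG, h⟩ := LocallyPresentable.exists_presentable_generator (C := C)
  have : Fact κ.IsRegular := ⟨hκ⟩
  have hP : (ObjectProperty.ofObj G).isoClosure.IsCardinalFilteredGenerator κ :=
    { le_isCardinalPresentable := by
        rw [ObjectProperty.isoClosure_le_iff]
        rintro _ ⟨i⟩
        exact (hG i).isCardinalPresentable
      exists_colimitsOfShape := fun X => by
        obtain ⟨J, F, c, hJ, ⟨hc⟩, hF, ⟨e⟩⟩ := h X
        refine ⟨J, inferInstance, (isCardinalFiltered_iff_mathlib J κ).1 hJ, ⟨?_⟩⟩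
        exact
          { diag := F
            ι := c.ι ≫ (Functor.const J).map e.hom
            isColimit := IsColimit.ofIsoColimit hc (Cocone.ext e (by simp))
            prop_diag_obj := fun j => by
              obtain ⟨i, ⟨e⟩⟩ := hF j
              exact ⟨G i, ⟨i⟩, ⟨e⟩⟩ } }
  have := hP.hasCardinalFilteredGenerator
  exact ⟨κ, inferInstance, { }⟩

instance hasTerminal_of_locallyPresentable [LocallyPresentable C] : HasTerminal C := by
  obtain ⟨κ, hκ, ι, G, -, h⟩ := LocallyPresentable.exists_presentable_generator (C := C)
  let T : C := colimit (inducedFunctor G)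
  have hT : ∀ X : Cᵒᵖ, Nonempty (Opposite.op T ⟶ X) := by
    intro X
    obtain ⟨J, F, c, -, ⟨hc⟩, hF, ⟨e⟩⟩ := h X.unop
    choose i hi using hF
    let φ : J ⥤ InducedCategory C G :=
      { obj := i
        map := fun {j j'} f =>
          InducedCategory.homMk ((hi j).some.inv ≫ F.map f ≫ (hi j').some.hom) }
    let t : Cocone F :=
      { pt := T
        ι :=
          { app := fun j => (hi j).some.hom ≫ colimit.ι (inducedFunctor G) (i j)
            naturality := fun j j' f => by
              have := colimit.w (inducedFunctor G) (φ.map f)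
              simp only [Functor.const_obj_obj, Functor.const_obj_map, Category.comp_id]
              rw [← this]
              simp [φ] } }
    exact ⟨(e.inv ≫ hc.desc t).op⟩
  have : HasInitial Cᵒᵖ := hasInitial_of_weakly_initial_and_hasWideEqualizers hT
  exact hasTerminal_of_hasInitial_op

lemma hasSmallObjectArgument_of_isSmall [LocallyPresentable C] (W : MorphismProperty C)
    [MorphismProperty.IsSmall.{v} W] : MorphismProperty.HasSmallObjectArgument.{v} W := by
  choose κ₀ h₀ h₀' using fun f : W.toSet =>
    Functor.IsAccessible.exists_cardinal (F := coyoneda.obj (Opposite.op f.1.left))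
      (self := (inferInstance : IsPresentable.{v} f.1.left))
  obtain ⟨κ, hκ, hle⟩ : ∃ κ : Cardinal.{v}, κ.IsRegular ∧ ∀ f, κ₀ f ≤ κ := by
    obtain ⟨κ, hκ, hlt⟩ := HasCardinalLT.exists_regular_cardinal_forall.{v}
      (fun f : Shrink.{v} W.toSet => (κ₀ ((equivShrink _).symm f)).out)
    refine ⟨κ, hκ, fun f => ?_⟩
    have := hlt (equivShrink _ f)
    simpa [HasCardinalLT] using this.le
  have : Fact κ.IsRegular := ⟨hκ⟩
  have : Nonempty κ.ord.ToType := by simpa using hκ.ne_zero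
  let _ : OrderBot κ.ord.ToType := WellFoundedLT.toOrderBot κ.ord.ToType
  refine ⟨κ, inferInstance, inferInstance, { preservesColimit := ?_ }⟩
  intro A B X Y i hi f hf
  have : (coyoneda.obj (Opposite.op A)).IsCardinalAccessible (κ₀ ⟨Arrow.mk i, hi⟩) :=
    h₀' ⟨Arrow.mk i, hi⟩
  have : IsCardinalPresentable A κ :=
    isCardinalPresentable_of_le A (hle ⟨Arrow.mk i, hi⟩)
  have := preservesColimitsOfShape_of_isCardinalPresentable A κ κ.ord.ToType
  infer_instance

end Presentability

lemma IsRightAnodyneClass.exists_factorization [LocallyPresentable C] {E : Cylinder C}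
    {L An : MorphismProperty C} (hAn : IsRightAnodyneClass E L An) {X Y : C} (f : X ⟶ Y) :
    ∃ (Z : C) (j : X ⟶ Z) (p : Z ⟶ Y), An j ∧ IsFib An p ∧ j ≫ p = f := by
  obtain ⟨Λ, hΛ, -, hAnΛ⟩ := hAn.exists_generating_set
  have : MorphismProperty.IsSmall.{v} (ofArrows Λ) := ⟨hΛ⟩
  have := hasSmallObjectArgument_of_isSmall (ofArrows Λ)
  let F := MorphismProperty.factorizationData (ofArrows Λ).rlp.llp (ofArrows Λ).rlp f
  refine ⟨F.Z, F.i, F.p, ?_, ?_, F.fac⟩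
  · rw [hAnΛ]
    exact fun _ _ g hg => F.hi g fun _ _ k hk => hg k hk
  · intro A B g hg
    rw [hAnΛ] at hg
    exact hg F.p fun _ _ k hk => F.hp k hk

lemma isFib_terminal_from [HasTerminal C] {An : MorphismProperty C} {W : C}
    (hW : IsFibrantObj An W) : IsFib An (terminal.from W) := by
  refine fun A B f hf => ⟨fun {a b} sq => ?_⟩
  obtain ⟨l, hl⟩ := hW f hf a
  exact ⟨⟨⟨l, hl, Subsingleton.elim _ _⟩⟩⟩

lemma IsFib.isFibrantObj {An : MorphismProperty C} {X Y : C} {p : X ⟶ Y} (hp : IsFib An p)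
    (hY : IsFibrantObj An Y) : IsFibrantObj An X := by
  intro A B f hf a
  obtain ⟨b, hb⟩ := hY f hf (a ≫ p)
  have := hp f hf
  have sq : CommSq a f p b := ⟨hb.symm⟩
  exact ⟨sq.lift, sq.fac_left⟩

lemma IsRightAnodyneClass.exists_fibrant_replacement [LocallyPresentable C] {E : Cylinder C}
    {L An : MorphismProperty C} (hAn : IsRightAnodyneClass E L An) (X : C) :
    ∃ (X' : C) (j : X ⟶ X'), An j ∧ IsFibrantObj An X' := by
  obtain ⟨X', j, p, hj, hp, -⟩ := hAn.exists_factorization (terminal.from X)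
  exact ⟨X', j, hj, hp.isFibrantObj fun _ _ _ _ _ => ⟨terminal.from _, Subsingleton.elim _ _⟩⟩

section Cylinder

variable [HasColimits C] {E : Cylinder C} {L An : MorphismProperty C}

lemma Cylinder.inl_ι (E : Cylinder C) (X : C) : coprod.inl ≫ E.ι X = E.d0.app X :=
  coprod.inl_desc _ _

lemma Cylinder.inr_ι (E : Cylinder C) (X : C) : coprod.inr ≫ E.ι X = E.d1.app X :=
  coprod.inr_desc _ _

lemma Cylinder.inl_box1 (E : Cylinder C) {K M : C} (f : K ⟶ M) :
    pushout.inl _ _ ≫ E.box1 f = E.d1.app M :=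
  pushout.inl_desc _ _ _

lemma Cylinder.inr_box1 (E : Cylinder C) {K M : C} (f : K ⟶ M) :
    pushout.inr _ _ ≫ E.box1 f = E.I.map f :=
  pushout.inr_desc _ _ _

lemma Cylinder.exists_lift_of_box1 {K M X Y : C} (f : K ⟶ M) (p : X ⟶ Y)
    [HasLiftingProperty (E.box1 f) p] (a : M ⟶ X) (h : E.I.obj K ⟶ X) (b : E.I.obj M ⟶ Y)
    (w : f ≫ a = E.d1.app K ≫ h) (wa : a ≫ p = E.d1.app M ≫ b)
    (wh : h ≫ p = E.I.map f ≫ b) :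
    ∃ H : E.I.obj M ⟶ X, E.d1.app M ≫ H = a ∧ E.I.map f ≫ H = h ∧ H ≫ p = b := by
  have sq : CommSq (pushout.desc a h w) (E.box1 f) p b :=
    ⟨by
      apply pushout.hom_ext
      · rw [pushout.inl_desc_assoc, reassoc_of% (E.inl_box1 f), wa]
      · rw [pushout.inr_desc_assoc, reassoc_of% (E.inr_box1 f), wh]⟩
  refine ⟨sq.lift, ?_, ?_, sq.fac_right⟩
  · rw [← E.inl_box1 f, Category.assoc, sq.fac_left, pushout.inl_desc]
  · rw [← E.inr_box1 f, Category.assoc, sq.fac_left, pushout.inr_desc]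

/-- The cylinder on a binary coproduct is the coproduct of the cylinders. -/
noncomputable def IsExactCylinder.isColimitMapCoprod (hE : IsExactCylinder E L) (X : C) :
    IsColimit (BinaryCofan.mk (E.I.map (coprod.inl : X ⟶ X ⨿ X))
      (E.I.map (coprod.inr : X ⟶ X ⨿ X))) :=
  have := hE.preservesColimits
  mapIsColimitOfPreservesOfIsColimit E.I _ _ (coprodIsCoprod X X)

lemma IsExactCylinder.exists_map_coprod_desc (hE : IsExactCylinder E L) {X Z : C}
    (h₀ h₁ : E.I.obj X ⟶ Z) :
    ∃ h : E.I.obj (X ⨿ X) ⟶ Z, E.I.map coprod.inl ≫ h = h₀ ∧ E.I.map coprod.inr ≫ h = h₁ :=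
  let ⟨h, hl, hr⟩ := BinaryCofan.IsColimit.desc' (hE.isColimitMapCoprod X) h₀ h₁
  ⟨h, hl, hr⟩

lemma IsExactCylinder.map_coprod_hom_ext (hE : IsExactCylinder E L) {X Z : C}
    {h k : E.I.obj (X ⨿ X) ⟶ Z} (hl : E.I.map coprod.inl ≫ h = E.I.map coprod.inl ≫ k)
    (hr : E.I.map coprod.inr ≫ h = E.I.map coprod.inr ≫ k) : h = k :=
  BinaryCofan.IsColimit.hom_ext (hE.isColimitMapCoprod X) hl hr

/-- Lifting in a square of homotopies whose sides and end are prescribed. -/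
lemma IsExactCylinder.exists_lift_of_box1_ι (hE : IsExactCylinder E L) {X Z Y : C} (p : Z ⟶ Y)
    [HasLiftingProperty (E.box1 (E.ι X)) p] (h₀ h₁ e : E.I.obj X ⟶ Z)
    (b : E.I.obj (E.I.obj X) ⟶ Y)
    (w₀ : E.d0.app X ≫ e = E.d1.app X ≫ h₀) (w₁ : E.d1.app X ≫ e = E.d1.app X ≫ h₁)
    (we : e ≫ p = E.d1.app (E.I.obj X) ≫ b) (wh₀ : h₀ ≫ p = E.I.map (E.d0.app X) ≫ b)
    (wh₁ : h₁ ≫ p = E.I.map (E.d1.app X) ≫ b) :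
    ∃ k : E.I.obj X ⟶ Z, E.d0.app X ≫ k = E.d0.app X ≫ h₀ ∧
      E.d1.app X ≫ k = E.d0.app X ≫ h₁ ∧ k ≫ p = E.d0.app (E.I.obj X) ≫ b := by
  obtain ⟨h, hl, hr⟩ := hE.exists_map_coprod_desc h₀ h₁
  have il := E.inl_ι X
  have ir := E.inr_ι X
  have nl := E.d1_naturality' (coprod.inl : X ⟶ X ⨿ X)
  have nr := E.d1_naturality' (coprod.inr : X ⟶ X ⨿ X)
  simp only [Functor.id_obj] at il ir nl nr
  obtain ⟨H, -, hH, hHp⟩ := E.exists_lift_of_box1 (E.ι X) p e h b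
    (by
      apply coprod.hom_ext
      · rw [reassoc_of% il, reassoc_of% nl, hl, w₀]
      · rw [reassoc_of% ir, reassoc_of% nr, hr, w₁])
    we
    (hE.map_coprod_hom_ext
      (by rw [reassoc_of% hl, wh₀, ← il, E.I.map_comp, Category.assoc])
      (by rw [reassoc_of% hr, wh₁, ← ir, E.I.map_comp, Category.assoc]))
  have hH₀ : E.I.map (E.d0.app X) ≫ H = h₀ := by
    rw [← il, E.I.map_comp, Category.assoc, hH, hl]
  have hH₁ : E.I.map (E.d1.app X) ≫ H = h₁ := by
    rw [← ir, E.I.map_comp, Category.assoc, hH, hr]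
  refine ⟨E.d0.app (E.I.obj X) ≫ H, ?_, ?_, by rw [Category.assoc, hHp]⟩
  · rw [← Category.assoc, E.d0_naturality', Category.assoc, hH₀]; rfl
  · rw [← Category.assoc, E.d0_naturality', Category.assoc, hH₁]; rfl

lemma IsFib.exists_lift_of_homotopy [HasInitial C] (hW : ∀ X : C, L (initial.to X))
    (hE : IsExactCylinder E L) (hAn : IsRightAnodyneClass E L An) {A X Y : C} {p : X ⟶ Y}
    (hp : IsFib An p) (a : A ⟶ X) (b : E.I.obj A ⟶ Y) (w : a ≫ p = E.d1.app A ≫ b) :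
    ∃ H : E.I.obj A ⟶ X, E.d1.app A ≫ H = a ∧ H ≫ p = b := by
  have := hE.preservesColimits
  have hI : IsInitial (E.I.obj (⊥_ C)) := initialIsInitial.isInitialObj E.I _
  have := hp _ (hAn.box1_mem _ (hW A))
  obtain ⟨H, h₁, -, h₂⟩ := E.exists_lift_of_box1 (initial.to A) p a (hI.to X) b
    (initialIsInitial.hom_ext _ _) w (hI.hom_ext _ _)
  exact ⟨H, h₁, h₂⟩

lemma Cylinder.inl_boundaryBox {K M : C} (f : K ⟶ M) :
    pushout.inl _ _ ≫ E.boundaryBox f = E.ι M :=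
  pushout.inl_desc _ _ _

lemma Cylinder.Homotopy.refl {X Y : C} (f : X ⟶ Y) : E.Homotopy f f :=
  ⟨E.σ.app X ≫ f, by rw [reassoc_of% (E.d0_σ X)], by rw [reassoc_of% (E.d1_σ X)]⟩

lemma Cylinder.Homotopy.comp_right {X Y Z : C} {f g : X ⟶ Y} (h : E.Homotopy f g) (k : Y ⟶ Z) :
    E.Homotopy (f ≫ k) (g ≫ k) := by
  obtain ⟨h, rfl, rfl⟩ := h
  exact ⟨h ≫ k, by simp, by simp⟩

lemma homotopy_of_homotopy_common_target [HasTerminal C] (hE : IsExactCylinder E L)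
    (hAn : IsRightAnodyneClass E L An) {X W : C} (hW : IsFibrantObj An W) {f g k : X ⟶ W}
    (hf : E.Homotopy f k) (hg : E.Homotopy g k) : E.Homotopy f g := by
  obtain ⟨h₀, rfl, h₀'⟩ := hf
  obtain ⟨h₁, rfl, h₁'⟩ := hg
  have := isFib_terminal_from hW _ (hAn.box1_mem _ (hE.ι_mem X))
  obtain ⟨H, hH₀, hH₁, -⟩ := hE.exists_lift_of_box1_ι (terminal.from W) h₀ h₁
    (E.σ.app X ≫ k) (terminal.from _)
    (by rw [reassoc_of% (E.d0_σ X), h₀'])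
    (by rw [reassoc_of% (E.d1_σ X), h₁'])
    (Subsingleton.elim _ _) (Subsingleton.elim _ _) (Subsingleton.elim _ _)
  exact ⟨H, hH₀, hH₁⟩

lemma homotopy_equivalence [HasTerminal C] (hE : IsExactCylinder E L)
    (hAn : IsRightAnodyneClass E L An) (X : C) {W : C} (hW : IsFibrantObj An W) :
    Equivalence fun f g : X ⟶ W => E.Homotopy f g where
  refl := .refl
  symm h := homotopy_of_homotopy_common_target hE hAn hW (.refl _) h
  trans h k := homotopy_of_homotopy_common_target hE hAn hW h
    (homotopy_of_homotopy_common_target hE hAn hW (.refl _) k)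

lemma homotopy_of_quot_mk_eq [HasTerminal C] (hE : IsExactCylinder E L)
    (hAn : IsRightAnodyneClass E L An) {X W : C} (hW : IsFibrantObj An W) {f g : X ⟶ W}
    (h : (Quot.mk _ f : E.HoHom X W) = Quot.mk _ g) : E.Homotopy f g :=
  (homotopy_equivalence hE hAn X hW).eqvGen_iff.1 (Quot.eqvGen_exact h)

lemma IsRightAnodyneClass.isWeakEq [HasTerminal C] (hE : IsExactCylinder E L)
    (hAn : IsRightAnodyneClass E L An) {A B : C} {j : A ⟶ B} (hj : An j) :
    IsWeakEq E An j := by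
  refine fun W hW => ⟨?_, ?_⟩
  · rintro ⟨f⟩ ⟨g⟩ hfg
    obtain ⟨h, h₀, h₁⟩ := homotopy_of_quot_mk_eq hE hAn hW hfg
    obtain ⟨H, hH⟩ := hW _ (hAn.boundaryBox_mem j hj)
      (pushout.desc (coprod.desc f g) h (by
        apply coprod.hom_ext <;> simp [Cylinder.ι, h₀, h₁]))
    have hι : E.ι B ≫ H = coprod.desc f g := by
      rw [← E.inl_boundaryBox j, Category.assoc, hH, pushout.inl_desc]
    refine Quot.sound ⟨H, ?_, ?_⟩
    · have := coprod.inl ≫= hι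
      rwa [← Category.assoc, E.inl_ι, coprod.inl_desc] at this
    · have := coprod.inr ≫= hι
      rwa [← Category.assoc, E.inr_ι, coprod.inr_desc] at this
  · refine Quot.ind fun a => ?_
    obtain ⟨b, hb⟩ := hW j hj a
    exact ⟨Quot.mk _ b, congrArg (Quot.mk _) hb⟩

lemma Cylinder.precompQ_comp {A B D : C} (f : A ⟶ B) (g : B ⟶ D) (W : C) :
    E.precompQ (f ≫ g) W = E.precompQ f W ∘ E.precompQ g W :=
  funext (Quot.ind fun k => congrArg (Quot.mk _) (Category.assoc f g k))

lemma IsWeakEq.comp {A B D : C} {f : A ⟶ B} {g : B ⟶ D} (hf : IsWeakEq E An f)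
    (hg : IsWeakEq E An g) : IsWeakEq E An (f ≫ g) := fun W hW => by
  rw [Cylinder.precompQ_comp]
  exact (hf W hW).comp (hg W hW)

lemma IsWeakEq.of_comp_left {A B D : C} {f : A ⟶ B} {g : B ⟶ D} (hf : IsWeakEq E An f)
    (hfg : IsWeakEq E An (f ≫ g)) : IsWeakEq E An g := fun W hW => by
  have h := hfg W hW
  rw [Cylinder.precompQ_comp] at h
  exact (Function.Bijective.of_comp_iff' (hf W hW) _).1 h

/-- The first map of a composable triple is a weak equivalence if both binary composites are. -/
lemma IsWeakEq.of_two_out_of_six {A B D D' : C} {f : A ⟶ B} {g : B ⟶ D} {h : D ⟶ D'}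
    (hfg : IsWeakEq E An (f ≫ g)) (hgh : IsWeakEq E An (g ≫ h)) : IsWeakEq E An f := by
  intro W hW
  have hfg := hfg W hW
  have hgh := hgh W hW
  rw [Cylinder.precompQ_comp] at hfg hgh
  have hg : Function.Bijective (E.precompQ g W) :=
    ⟨hfg.injective.of_comp, hgh.surjective.of_comp⟩
  exact (Function.Bijective.of_comp_iff _ hg).1 hfg

variable [HasTerminal C]

lemma IsFib.exists_section_of_isWeakEq (hW : ∀ X : C, L (initial.to X))
    (hE : IsExactCylinder E L) (hAn : IsRightAnodyneClass E L An) {X Y : C} {q : X ⟶ Y}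
    (hq : IsFib An q) (hY : IsFibrantObj An Y) (hqw : IsWeakEq E An q) :
    ∃ s : Y ⟶ X, s ≫ q = 𝟙 Y ∧ E.Homotopy (𝟙 X) (q ≫ s) := by
  have hX := hq.isFibrantObj hY
  obtain ⟨⟨s⟩, hs⟩ := (hqw X hX).surjective (Quot.mk _ (𝟙 X))
  have hsX : E.Homotopy (q ≫ s) (𝟙 X) := homotopy_of_quot_mk_eq hE hAn hX hs
  have hsY : E.Homotopy (𝟙 Y) (s ≫ q) := by
    apply (homotopy_equivalence hE hAn Y hY).symm
    refine homotopy_of_quot_mk_eq hE hAn hY ((hqw Y hY).injective (Quot.sound ?_))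
    simpa using hsX.comp_right q
  obtain ⟨h, h₀, h₁⟩ := hsY
  obtain ⟨H, H₁, Hq⟩ := hq.exists_lift_of_homotopy hW hE hAn s h h₁.symm
  have eX := homotopy_equivalence hE hAn X hX
  refine ⟨E.d0.app Y ≫ H, by rw [Category.assoc, Hq, h₀], eX.trans (eX.symm hsX) (eX.symm ?_)⟩
  refine ⟨E.I.map q ≫ H, ?_, ?_⟩
  · rw [← Category.assoc, ← E.d0_naturality', Category.assoc]
  · rw [← Category.assoc, ← E.d1_naturality', Category.assoc, H₁]

lemma IsFib.exists_fiberwise_homotopy (hE : IsExactCylinder E L)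
    (hAn : IsRightAnodyneClass E L An) {X Y : C} {q : X ⟶ Y} (hq : IsFib An q) {s : Y ⟶ X}
    (hs : s ≫ q = 𝟙 Y) (h : E.Homotopy (𝟙 X) (q ≫ s)) :
    ∃ k : E.I.obj X ⟶ X, E.d0.app X ≫ k = 𝟙 X ∧ E.d1.app X ≫ k = q ≫ s ∧
      k ≫ q = E.σ.app X ≫ q := by
  obtain ⟨k, k₀, k₁⟩ := h
  have := hq _ (hAn.box1_mem _ (hE.ι_mem X))
  have hσ₀ : E.I.map (E.d0.app X) ≫ E.I.map (E.σ.app X) = 𝟙 _ := by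
    rw [← E.I.map_comp, E.d0_σ]; exact E.I.map_id X
  have hσ₁ : E.I.map (E.d1.app X) ≫ E.I.map (E.σ.app X) = 𝟙 _ := by
    rw [← E.I.map_comp, E.d1_σ]; exact E.I.map_id X
  have n₀ := E.d0_naturality' (E.σ.app X)
  have n₁ := E.d1_naturality' (E.σ.app X)
  simp only [Functor.id_obj] at n₀ n₁
  obtain ⟨k', k'₀, k'₁, k'q⟩ := hE.exists_lift_of_box1_ι q k (k ≫ q ≫ s) (E.σ.app X ≫ q ≫ s)
    (E.I.map (E.σ.app X) ≫ k ≫ q)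
    (by rw [reassoc_of% (E.d0_σ X), k₁])
    (by rw [reassoc_of% (E.d1_σ X), reassoc_of% k₁, reassoc_of% hs])
    (by rw [← reassoc_of% n₁, reassoc_of% k₁]; simp [hs])
    (by rw [reassoc_of% hσ₀])
    (by rw [reassoc_of% hσ₁]; simp [hs])
  refine ⟨k', by rw [k'₀, k₀], by rw [k'₁, reassoc_of% k₀], ?_⟩
  rw [k'q, ← reassoc_of% n₀, reassoc_of% k₀]

lemma IsFib.hasLiftingProperty_of_isWeakEq (hW : ∀ X : C, L (initial.to X))
    (hE : IsExactCylinder E L) (hAn : IsRightAnodyneClass E L An) {X Y : C} {q : X ⟶ Y}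
    (hq : IsFib An q) (hY : IsFibrantObj An Y) (hqw : IsWeakEq E An q)
    {A B : C} {j : A ⟶ B} (hj : L j) : HasLiftingProperty j q := by
  obtain ⟨s, hs, h⟩ := hq.exists_section_of_isWeakEq hW hE hAn hY hqw
  obtain ⟨k, k₀, k₁, kq⟩ := hq.exists_fiberwise_homotopy hE hAn hs h
  refine ⟨fun {a b} sq => ?_⟩
  have := hq _ (hAn.box1_mem _ hj)
  have σa : E.I.map a ≫ E.σ.app X = E.σ.app A ≫ a := E.σ.naturality a
  have σj : E.I.map j ≫ E.σ.app B = E.σ.app A ≫ j := E.σ.naturality j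
  obtain ⟨H, -, Hj, Hq⟩ := E.exists_lift_of_box1 j q (b ≫ s) (E.I.map a ≫ k) (E.σ.app B ≫ b)
    (by rw [← Category.assoc (E.d1.app A), ← E.d1_naturality', Category.assoc, k₁,
          ← reassoc_of% sq.w])
    (by rw [reassoc_of% (E.d1_σ B), Category.assoc, hs, Category.comp_id])
    (by rw [Category.assoc, kq, reassoc_of% σa, reassoc_of% σj, sq.w])
  refine ⟨⟨⟨E.d0.app B ≫ H, ?_, ?_⟩⟩⟩
  · rw [← Category.assoc, E.d0_naturality', Category.assoc, Hj, ← Category.assoc,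
      ← E.d0_naturality', Category.assoc, k₀, Category.comp_id]
  · rw [Category.assoc, Hq, reassoc_of% (E.d0_σ B)]

end Cylinder

/-- Proposition 2.28 (trivcof): a morphism of `L` is a weak equivalence iff it has the left
lifting property against all right `I`-fibrations with right `I`-fibrant codomain. -/
theorem statement_9    {C : Type u} [Category.{v} C] [LocallyPresentable C]
    (L R : MorphismProperty C) (hW : IsCofGenWFS L R)
    (E : Cylinder C) (hE : IsExactCylinder E L)
    (An : MorphismProperty C) (hAn : IsRightAnodyneClass E L An)
    ⦃K M : C⦄ (i : K ⟶ M) (hi : L i) :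
    IsWeakEq E An i ↔
      ∀ ⦃X Y : C⦄ (p : X ⟶ Y), IsFib An p → IsFibrantObj An Y →
        HasLiftingProperty i p := by
  obtain ⟨M', m, hm, hM'⟩ := hAn.exists_fibrant_replacement M
  obtain ⟨N, j, q, hj, hq, fac⟩ := hAn.exists_factorization (i ≫ m)
  have hmw := hAn.isWeakEq hE hm
  have hjw := hAn.isWeakEq hE hj
  have sq : CommSq j i q m := ⟨fac⟩
  constructor
  · intro hiw X Y p hp hY
    have hqw : IsWeakEq E An q := hjw.of_comp_left (fac ▸ hiw.comp hmw)
    have := hq.hasLiftingProperty_of_isWeakEq hW.initial_mem hE hAn hM' hqw hi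
    refine ⟨fun {a b} sq' => ?_⟩
    obtain ⟨b', hb'⟩ := hY m hm b
    have := hp j hj
    have sq'' : CommSq a j p (q ≫ b') := ⟨by rw [reassoc_of% fac, hb', sq'.w]⟩
    exact ⟨⟨⟨sq.lift ≫ sq''.lift, by simp, by simp [hb']⟩⟩⟩
  · intro h
    have := h q hq hM'
    refine IsWeakEq.of_two_out_of_six (g := sq.lift) (h := q) ?_ ?_
    · rwa [sq.fac_left]
    · rwa [sq.fac_right]

end Paper
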